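/- Let d be a prime, let k be a positive even integer such that d does not divide k/2, and let 1 ≤ m ≤ k. Then the operator (1/d) · Σ_{q,p ∈ ℤ/dℤ} D_{q,p}^{⊗m} ⊗ D_{−q,−p}^{⊗(k−m)} on (ℂ^d)^{⊗k} is a permutation matrix (it maps each computational basis vector of (ℂ^d)^{⊗k} to a computational basis vector, bijectively); in particular, the ℓ²→ℓ² operator norm of Σ_{q,p ∈ ℤ/dℤ} D_{q,p}^{⊗m} ⊗ D_{−q,−p}^{⊗(k−m)} equals d. -/

import Mathlib

open Matrix Complex

/-- `ω = exp(2πi/d)`. -/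
noncomputable def omega (d : ℕ) : ℂ := Complex.exp (2 * Real.pi * Complex.I / d)

/-- The shift matrix `X` on `ℂ^d`, acting by `X|j⟩ = |j+1⟩` (indices mod `d`). -/
noncomputable def Xmat (d : ℕ) [NeZero d] : Matrix (ZMod d) (ZMod d) ℂ :=
  Matrix.of fun i j => if i = j + 1 then 1 else 0

/-- The clock matrix `Z` on `ℂ^d`, acting by `Z|j⟩ = ω^j |j⟩`. -/
noncomputable def Zmat (d : ℕ) [NeZero d] : Matrix (ZMod d) (ZMod d) ℂ :=
  Matrix.diagonal fun j => omega d ^ (j.val)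

/-- The displacement operator `D_{q,p} = e^{iπqp/d} X^q Z^p`. -/
noncomputable def Dmat (d : ℕ) [NeZero d] (q p : ℤ) : Matrix (ZMod d) (ZMod d) ℂ :=
  Complex.exp (Real.pi * Complex.I * q * p / d) • (Xmat d ^ q * Zmat d ^ p)

/-- The operator `D_{q,p}^{⊗m} ⊗ D_{−q,−p}^{⊗(k−m)}` on `(ℂ^d)^{⊗k}`, with computational basis
indexed by `ℤ_d^k` (entries are products of the entries of the factors). -/
noncomputable def DmixPow (d : ℕ) [NeZero d] (k m : ℕ) (q p : ℤ) :
    Matrix (Fin k → ZMod d) (Fin k → ZMod d) ℂ :=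
  Matrix.of fun a b =>
    ∏ t : Fin k, (if (t : ℕ) < m then Dmat d q p else Dmat d (-q) (-p)) (a t) (b t)

/-- A one-parameter family of matrices `f` indexed by `ℤ` consists of the integer powers of
`f 1`. -/
theorem Matrix.zpow_eq_of_map_add {n : Type*} [Fintype n] [DecidableEq n]
    (f : ℤ → Matrix n n ℂ) (h0 : f 0 = 1) (hadd : ∀ a b, f (a + b) = f a * f b) (q : ℤ) :
    f 1 ^ q = f q := by
  have hnat : ∀ r : ℕ, f 1 ^ r = f r := by
    intro r
    induction r with
    | zero => simp [h0]
    | succ r ih => rw [pow_succ, ih, Nat.cast_succ, hadd]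
  obtain ⟨r, rfl | rfl⟩ := q.eq_nat_or_neg
  · rw [zpow_natCast, hnat]
  · rw [Matrix.zpow_neg_natCast, hnat]
    apply Matrix.inv_eq_right_inv
    rw [← hadd, add_neg_cancel, h0]

theorem AddChar.map_sum_eq_prod {ι A M : Type*} [AddCommMonoid A] [CommMonoid M]
    (ψ : AddChar A M) (s : Finset ι) (f : ι → A) : ψ (∑ i ∈ s, f i) = ∏ i ∈ s, ψ (f i) :=
  map_prod ψ.toMonoidHom (fun i => Multiplicative.ofAdd (f i)) s

theorem Xmat_zpow (d : ℕ) [NeZero d] (q : ℤ) :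
    Xmat d ^ q = Matrix.of fun i j : ZMod d => if i = j + (q : ZMod d) then (1 : ℂ) else 0 := by
  have h := Matrix.zpow_eq_of_map_add
    (fun q : ℤ => Matrix.of fun i j : ZMod d => if i = j + (q : ZMod d) then (1 : ℂ) else 0)
    (by ext i j; simp [Matrix.one_apply]) (by
      intro a b
      ext i j
      simp only [Matrix.mul_apply, Matrix.of_apply, mul_ite, mul_one, mul_zero,
        Finset.sum_ite_eq', Finset.mem_univ, if_true]
      congr 1
      push_cast
      rw [add_comm (a : ZMod d), add_assoc]) q
  rw [← h]
  simp [Xmat]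

theorem omega_pow_val (d : ℕ) [NeZero d] (j : ZMod d) :
    omega d ^ j.val = ZMod.stdAddChar j := by
  have h := ZMod.stdAddChar_coe (N := d) (j.val : ℤ)
  rw [Int.cast_natCast, ZMod.natCast_zmod_val] at h
  rw [h, omega, ← Complex.exp_nat_mul]
  congr 1
  push_cast
  ring

theorem Zmat_zpow (d : ℕ) [NeZero d] (p : ℤ) :
    Zmat d ^ p = Matrix.diagonal fun j => ZMod.stdAddChar ((p : ZMod d) * j) := by
  have h := Matrix.zpow_eq_of_map_add
    (fun p : ℤ => Matrix.diagonal fun j : ZMod d => (ZMod.stdAddChar ((p : ZMod d) * j) : ℂ))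
    (by simp) (by
      intro a b
      simp [add_mul, AddChar.map_add_eq_mul]) p
  rw [← h]
  simp [Zmat, omega_pow_val]

theorem Dmat_apply (d : ℕ) [NeZero d] (q p : ℤ) (a b : ZMod d) :
    Dmat d q p a b = if a = b + (q : ZMod d) then
      Complex.exp (Real.pi * Complex.I * q * p / d) * ZMod.stdAddChar ((p : ZMod d) * b)
      else 0 := by
  simp [Dmat, Xmat_zpow, Zmat_zpow]

/-- The sign vector with `m` leading entries `1` and all other entries `-1`. -/
def signVec (d k m : ℕ) (t : Fin k) : ZMod d := if (t : ℕ) < m then 1 else -1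

theorem signVec_dotProduct_self (d k m : ℕ) : signVec d k m ⬝ᵥ signVec d k m = k := by
  have h : ∀ t, signVec d k m t * signVec d k m t = 1 := fun t => by
    unfold signVec; split_ifs <;> simp
  simp [dotProduct, h]

theorem DmixPow_apply (d : ℕ) [NeZero d] (h m : ℕ) (q p : ℤ) (a b : Fin (h + h) → ZMod d) :
    DmixPow d (h + h) m q p a b =
      if a = b + (q : ZMod d) • signVec d (h + h) m then
        ZMod.stdAddChar ((p : ZMod d) * ((h : ZMod d) * (q : ZMod d) + signVec d (h + h) m ⬝ᵥ b)) else 0 := by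
  have hfac : ∀ t : Fin (h + h),
      (if (t : ℕ) < m then Dmat d q p else Dmat d (-q) (-p)) (a t) (b t) =
      if a t = b t + (q : ZMod d) * signVec d (h + h) m t then
        Complex.exp (Real.pi * Complex.I * q * p / d) *
          ZMod.stdAddChar ((p : ZMod d) * (signVec d (h + h) m t * b t)) else 0 := by
    intro t
    unfold signVec
    split_ifs <;> simp_all [Dmat_apply]
  have hphase : Complex.exp (Real.pi * Complex.I * q * p / d) ^ (h + h) =
      ZMod.stdAddChar ((p : ZMod d) * ((h : ZMod d) * (q : ZMod d))) := by
    have := ZMod.stdAddChar_coe (N := d) (p * (h * q))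
    push_cast at this
    rw [this, ← Complex.exp_nat_mul]
    congr 1
    push_cast
    ring
  simp only [DmixPow, Matrix.of_apply, hfac]
  rw [Fintype.prod_ite_zero]
  have hiff : (∀ t, a t = b t + (q : ZMod d) * signVec d (h + h) m t) ↔
      a = b + (q : ZMod d) • signVec d (h + h) m := by
    simp [funext_iff]
  simp only [hiff]
  rw [Finset.prod_mul_distrib, Finset.prod_const, Finset.card_univ, Fintype.card_fin, hphase,
    mul_add, AddChar.map_add_eq_mul, dotProduct, Finset.mul_sum, AddChar.map_sum_eq_prod]

theorem sum_DmixPow_apply (d : ℕ) [NeZero d] (h m : ℕ) (hu : IsUnit (h : ZMod d))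
    (a b : Fin (h + h) → ZMod d) :
    (∑ q : ZMod d, ∑ p : ZMod d, DmixPow d (h + h) m q.val p.val) a b =
      if a = b + (-(h : ZMod d)⁻¹ * (signVec d (h + h) m ⬝ᵥ b)) • signVec d (h + h) m
        then (d : ℂ) else 0 := by
  have hsum : ∀ c : ZMod d, ∑ p : ZMod d, (ZMod.stdAddChar (p * c) : ℂ) =
      if c = 0 then (d : ℂ) else 0 := fun c => by
    rw [AddChar.sum_mulShift c (ZMod.isPrimitive_stdAddChar d), ZMod.card]
    split_ifs <;> simp
  have hsolve : ∀ q c : ZMod d, h * q + c = 0 ↔ q = -(h : ZMod d)⁻¹ * c := by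
    intro q c
    have h1 := ZMod.mul_inv_of_unit _ hu
    constructor <;> intro hq
    · linear_combination (h : ZMod d)⁻¹ * hq - q * h1
    · linear_combination (h : ZMod d) * hq - c * h1
  have hinner : ∀ q : ZMod d, ∑ p : ZMod d, DmixPow d (h + h) m q.val p.val a b =
      if q = -(h : ZMod d)⁻¹ * (signVec d (h + h) m ⬝ᵥ b) then
        if a = b + q • signVec d (h + h) m then (d : ℂ) else 0 else 0 := by
    intro q
    simp only [DmixPow_apply, Int.cast_natCast, ZMod.natCast_zmod_val, ← hsolve]
    by_cases hq : a = b + q • signVec d (h + h) m <;> simp [hq, hsum]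
  simp only [Matrix.sum_apply, hinner, Finset.sum_ite_eq', Finset.mem_univ, if_true]

theorem reflection_involutive {R n : Type*} [CommRing R] [Fintype n] (s : n → R) (c : R)
    (hc : c * (s ⬝ᵥ s) = -2) :
    Function.Involutive fun b : n → R => b + (c * (s ⬝ᵥ b)) • s := by
  intro b
  ext t
  simp only [dotProduct_add, dotProduct_smul, Pi.add_apply, Pi.smul_apply, smul_eq_mul]
  linear_combination (c * (s ⬝ᵥ b) * s t) * hc

open scoped Matrix.Norms.L2Operator in
theorem norm_toEuclideanCLM_perm {n : Type*} [Fintype n] [DecidableEq n] [Nonempty n]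
    (σ : Equiv.Perm n) :
    ‖Matrix.toEuclideanCLM (𝕜 := ℂ)
      (Matrix.of fun a b => if a = σ b then (1 : ℂ) else 0)‖ = 1 := by
  rw [← Matrix.cstar_norm_def, ← Matrix.permMatrix_l2_opNorm_eq (𝕜 := ℂ) σ⁻¹]
  congr 1
  ext a b
  simp [PEquiv.toMatrix_apply, Equiv.eq_symm_apply, eq_comm]

theorem displacement_sum_permutation (d : ℕ) [NeZero d] (hp : d.Prime)
    (k m : ℕ) (hk : 0 < k) (hke : Even k) (hdk : ¬ (d ∣ k / 2))
    (hm1 : 1 ≤ m) (hmk : m ≤ k) :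
    (∃ σ : Equiv.Perm (Fin k → ZMod d),
      (1 / (d : ℂ)) • (∑ q : ZMod d, ∑ p : ZMod d, DmixPow d k m q.val p.val) =
        Matrix.of fun a b => if a = σ b then (1 : ℂ) else 0) ∧
    ‖Matrix.toEuclideanCLM (𝕜 := ℂ)
        (∑ q : ZMod d, ∑ p : ZMod d, DmixPow d k m q.val p.val)‖ = d := by
  obtain ⟨h, rfl⟩ := hke
  have hd : (d : ℂ) ≠ 0 := Nat.cast_ne_zero.mpr (NeZero.ne d)
  have hu : IsUnit (h : ZMod d) := by
    rw [ZMod.isUnit_iff_coprime, Nat.coprime_comm, hp.coprime_iff_not_dvd]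
    rwa [show (h + h) / 2 = h by omega] at hdk
  have hinv := reflection_involutive (signVec d (h + h) m) (-(h : ZMod d)⁻¹) (by
    rw [signVec_dotProduct_self]
    push_cast
    linear_combination -2 * ZMod.mul_inv_of_unit _ hu)
  have hperm : (1 / (d : ℂ)) • (∑ q : ZMod d, ∑ p : ZMod d, DmixPow d (h + h) m q.val p.val) =
      Matrix.of fun a b => if a = hinv.toPerm _ b then (1 : ℂ) else 0 := by
    ext a b
    rw [Matrix.smul_apply, sum_DmixPow_apply d h m hu]
    simp [hd]
  refine ⟨⟨_, hperm⟩, ?_⟩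
  have hM := congrArg ((d : ℂ) • ·) hperm
  simp only [one_div, smul_inv_smul₀ hd] at hM
  rw [hM, map_smul, norm_smul, norm_toEuclideanCLM_perm]
  simp
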